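/- Let I ≥ 2 and J ≥ 1 be integers, let T ∈ ℂ^{I×J} and F ∈ ℂ^{J×J} satisfy J₁T = J₂TF (i.e., the k-th row of T equals the (k+1)-th row of T multiplied on the right by F, for every k = 1,…,I−1). For k = 1,…,I let t_k ∈ ℂ^J denote the k-th column of Tᴴ (the conjugate transpose of the k-th row of T). Suppose Q ∈ ℂ^{J×J} satisfies Q t_I = 0 and Q (Fᴴ t_1) = 0. Then for every ω ∈ ℝ, the beamspace vector b(ω) := Tᴴ a^{(I)}(ω) ∈ ℂ^J satisfies Q Fᴴ b(ω) = exp(jω) · Q b(ω). -/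

import Mathlib

open Matrix

/-- The vector `a^{(I)}(ω) ∈ ℂ^I` with `k`-th (0-indexed) entry `exp(j k ω)`. -/
noncomputable def aVec (I : ℕ) (ω : ℝ) : Fin I → ℂ :=
  fun k => Complex.exp (Complex.I * ((k : ℕ) : ℂ) * (ω : ℂ))

/-- The selection matrix `J₁ = [I_{I-1}, 0]` keeping the first `I-1` rows. -/
def selFirst (I : ℕ) : Matrix (Fin (I - 1)) (Fin I) ℂ :=
  fun k i => if (i : ℕ) = (k : ℕ) then 1 else 0

/-- The selection matrix `J₂ = [0, I_{I-1}]` keeping the last `I-1` rows. -/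
def selLast (I : ℕ) : Matrix (Fin (I - 1)) (Fin I) ℂ :=
  fun k i => if (i : ℕ) = (k : ℕ) + 1 then 1 else 0

theorem selFirst_mul_apply {n J : ℕ} (T : Matrix (Fin (n + 1)) (Fin J) ℂ) (k : Fin n)
    (j : Fin J) : (selFirst (n + 1) * T : Matrix (Fin n) (Fin J) ℂ) k j = T k.castSucc j := by
  rw [Matrix.mul_apply, Finset.sum_eq_single k.castSucc]
  · simp [selFirst]
  · intro i _ hi
    simp [selFirst, show (i : ℕ) ≠ k from fun h => hi (Fin.ext h)]
  · simp

theorem selLast_mul_apply {n J : ℕ} (T : Matrix (Fin (n + 1)) (Fin J) ℂ) (k : Fin n)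
    (j : Fin J) : (selLast (n + 1) * T : Matrix (Fin n) (Fin J) ℂ) k j = T k.succ j := by
  rw [Matrix.mul_apply, Finset.sum_eq_single k.succ]
  · simp [selLast]
  · intro i _ hi
    simp [selLast, show (i : ℕ) ≠ k + 1 from fun h => hi (Fin.ext h)]
  · simp

theorem aVec_succ {n : ℕ} (ω : ℝ) (k : Fin n) :
    aVec (n + 1) ω k.succ = Complex.exp (Complex.I * (ω : ℂ)) * aVec (n + 1) ω k.castSucc := by
  simp only [aVec, ← Complex.exp_add]
  congr 1
  push_cast [Fin.val_succ, Fin.val_castSucc]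
  ring

/-- The shift relation between rows of `T`, read on the columns of `Tᴴ`. -/
theorem conjTranspose_mulVec_star_row_succ {n J : ℕ} {T : Matrix (Fin (n + 1)) (Fin J) ℂ}
    {F : Matrix (Fin J) (Fin J) ℂ}
    (hTF : selFirst (n + 1) * T = selLast (n + 1) * T * F) (k : Fin n) :
    Fᴴ *ᵥ star (T k.succ) = star (T k.castSucc) := by
  rw [← Matrix.star_vecMul]
  congr 1
  ext j
  have h := selFirst_mul_apply T k j
  rw [hTF, Matrix.mul_assoc] at h
  exact (selLast_mul_apply (T * F) k j).symm.trans h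

/-- `Tᴴ a` as a combination of the columns of `Tᴴ`, after applying a matrix `M`. -/
theorem mulVec_conjTranspose_mulVec {m n p : ℕ} (M : Matrix (Fin p) (Fin n) ℂ)
    (T : Matrix (Fin m) (Fin n) ℂ) (a : Fin m → ℂ) :
    M *ᵥ (Tᴴ *ᵥ a) = ∑ k, a k • (M *ᵥ star (T k)) := by
  rw [Matrix.mulVec_eq_sum a Tᴴ, Matrix.mulVec_sum]
  refine Finset.sum_congr rfl fun k _ => ?_
  rw [op_smul_eq_smul, Matrix.mulVec_smul]
  rfl

/-- Restored shift-invariance for beamspace ESPRIT, single-frequency form: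
if `J₁ T = J₂ T F`, `Q t_I = 0` and `Q (Fᴴ t_1) = 0` (where `t_k` is the `k`-th
column of `Tᴴ`), then the beamspace vector `b(ω) = Tᴴ a^{(I)}(ω)` satisfies
`Q Fᴴ b(ω) = exp(jω) • Q b(ω)`. -/
theorem stmt1 (I J : ℕ) (hI : 2 ≤ I) (hJ : 1 ≤ J)
    (T : Matrix (Fin I) (Fin J) ℂ) (F : Matrix (Fin J) (Fin J) ℂ)
    (hTF : selFirst I * T = selLast I * T * F)
    (Q : Matrix (Fin J) (Fin J) ℂ)
    (hQ1 : Q.mulVec (fun i => star (T ⟨I - 1, by omega⟩ i)) = 0)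
    (hQ2 : Q.mulVec (Fᴴ.mulVec (fun i => star (T ⟨0, by omega⟩ i))) = 0)
    (ω : ℝ) :
    (Q * Fᴴ).mulVec (Tᴴ.mulVec (aVec I ω)) =
      Complex.exp (Complex.I * (ω : ℂ)) • Q.mulVec (Tᴴ.mulVec (aVec I ω)) := by
  obtain ⟨n, rfl⟩ : ∃ n, I = n + 1 := ⟨I - 1, by omega⟩
  have hlast : Q *ᵥ star (T (Fin.last n)) = 0 := hQ1
  have hzero : (Q * Fᴴ) *ᵥ star (T 0) = 0 := by
    rw [← Matrix.mulVec_mulVec]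
    exact hQ2
  rw [mulVec_conjTranspose_mulVec, mulVec_conjTranspose_mulVec, Fin.sum_univ_succ,
    Fin.sum_univ_castSucc, hzero, hlast, smul_zero, smul_zero, zero_add, add_zero,
    Finset.smul_sum]
  refine Finset.sum_congr rfl fun k _ => ?_
  rw [← Matrix.mulVec_mulVec, conjTranspose_mulVec_star_row_succ hTF, aVec_succ, mul_smul]
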